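/- Proposition. Let a : ℕ → ℂ be a sequence with a_n ∈ {0,1} for every n, a_0 = 1, and a_n = 1 for infinitely many n (so limsup_{n→∞} |a_n|^{1/n} = 1), and let Γ be the index of the power series f(z) = ∑_{n≥0} a_n z^n. Then the set of weak limit points of the sequence (ρ_n)_{n≥1} of probability measures on [0,+∞] is exactly { (1−u)·δ_1 + u·δ_{+∞} : 0 ≤ u ≤ Γ }; that is, a probability measure ρ on [0,+∞] is the weak limit of ρ_{n_k} along some strictly increasing sequence (n_k) if and only if ρ = (1−u)·δ_1 + u·δ_{+∞} for some u ∈ [0,Γ]. -/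

import Mathlib

open Filter MeasureTheory Polynomial
open scoped ENNReal

noncomputable def sect (a : ℕ → ℂ) (n : ℕ) : Polynomial ℂ :=
  ∑ k ∈ Finset.range (n + 1), Polynomial.C (a k) * Polynomial.X ^ k

noncomputable def Acoef (a : ℕ → ℂ) (γ : ℝ) (n : ℕ) : ℝ :=
  ((((Finset.range (n + 1)).filter (fun k : ℕ => (1 - γ) * (n : ℝ) ≤ (k : ℝ))).sup
    (fun k => ‖a k‖₊) : NNReal) : ℝ)

noncomputable def Lgauge (a : ℕ → ℂ) (γ : ℝ) : ℝ :=
  Filter.liminf (fun n => Acoef a γ n ^ (1 / (n : ℝ))) Filter.atTop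

open Classical in
noncomputable def indexGamma (a : ℕ → ℂ) : ℝ :=
  if ∃ γ ∈ Set.Ioo (0 : ℝ) 1, Lgauge a γ = 1 then
    sInf {γ : ℝ | γ ∈ Set.Ioo (0 : ℝ) 1 ∧ Lgauge a γ = 1}
  else 1

/-- The radial zero counting (probability) measure of the `n`-th section, on the compact
space `[0,+∞]`: a Dirac mass at `|w|` for each root `w` of `s_n` (with multiplicity), and
a mass `n - deg s_n` at `+∞`, the total normalized by `1/n`. -/
noncomputable def rho (a : ℕ → ℂ) (n : ℕ) : Measure ℝ≥0∞ :=
  (n : ℝ≥0∞)⁻¹ •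
    (((sect a n).roots.map (fun w => Measure.dirac ((‖w‖₊ : ℝ≥0∞)))).sum
      + (n - (sect a n).natDegree) • Measure.dirac (⊤ : ℝ≥0∞))

lemma coeff_sect (a : ℕ → ℂ) (n k : ℕ) :
    (sect a n).coeff k = if k ≤ n then a k else 0 := by
  simp [sect, finsetSum_coeff, coeff_C_mul, coeff_X_pow]

lemma sect_ne_zero {a : ℕ → ℂ} (h0 : a 0 = 1) (n : ℕ) : sect a n ≠ 0 := by
  intro h
  have := coeff_sect a n 0
  simp [h, h0] at this

lemma natDegree_sect_le (a : ℕ → ℂ) (n : ℕ) : (sect a n).natDegree ≤ n := by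
  rw [natDegree_le_iff_coeff_eq_zero]
  intro k hk
  rw [coeff_sect, if_neg (by omega)]

lemma le_natDegree_sect {a : ℕ → ℂ} {n k : ℕ} (hk : k ≤ n) (ha : a k ≠ 0) :
    k ≤ (sect a n).natDegree :=
  le_natDegree_of_ne_zero (by rwa [coeff_sect, if_pos hk])

lemma leadingCoeff_sect (a : ℕ → ℂ) (n : ℕ) :
    (sect a n).leadingCoeff = a (sect a n).natDegree := by
  rw [leadingCoeff, coeff_sect, if_pos (natDegree_sect_le a n)]

lemma apply_natDegree_sect_ne_zero {a : ℕ → ℂ} (h0 : a 0 = 1) (n : ℕ) :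
    a (sect a n).natDegree ≠ 0 := by
  rw [← leadingCoeff_sect a]
  exact leadingCoeff_ne_zero.mpr (sect_ne_zero h0 n)

lemma apply_natDegree_sect {a : ℕ → ℂ} (hval : ∀ n, a n = 0 ∨ a n = 1) (h0 : a 0 = 1) (n : ℕ) :
    a (sect a n).natDegree = 1 :=
  (hval _).resolve_left (apply_natDegree_sect_ne_zero h0 n)

lemma natDegree_sect_mono {a : ℕ → ℂ} (h0 : a 0 = 1) :
    Monotone fun n : ℕ => (sect a n).natDegree := fun m _ hmn =>
  le_natDegree_sect ((natDegree_sect_le a m).trans hmn) (apply_natDegree_sect_ne_zero h0 m)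

/-- The proportion of the zeros of the `n`-th section that sit at infinity. -/
noncomputable def degreeGap (a : ℕ → ℂ) (n : ℕ) : ℝ := 1 - (sect a n).natDegree / n

lemma degreeGap_nonneg (a : ℕ → ℂ) (n : ℕ) : 0 ≤ degreeGap a n := by
  have : ((sect a n).natDegree : ℝ) / n ≤ 1 :=
    div_le_one_of_le₀ (by exact_mod_cast natDegree_sect_le a n) (by positivity)
  rw [degreeGap]
  linarith

lemma degreeGap_le_one (a : ℕ → ℂ) (n : ℕ) : degreeGap a n ≤ 1 := by
  have : (0 : ℝ) ≤ (sect a n).natDegree / n := by positivity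
  rw [degreeGap]
  linarith

lemma degreeGap_le_iff {a : ℕ → ℂ} {n : ℕ} (hn : 0 < n) (γ : ℝ) :
    degreeGap a n ≤ γ ↔ (1 - γ) * n ≤ (sect a n).natDegree := by
  have hn' : (0 : ℝ) < n := by exact_mod_cast hn
  rw [degreeGap, sub_le_comm, le_div_iff₀ hn']

lemma degreeGap_succ_le {a : ℕ → ℂ} (h0 : a 0 = 1) {n : ℕ} (hn : 0 < n) :
    degreeGap a (n + 1) ≤ degreeGap a n + 1 / (n + 1) := by
  have hn' : (0 : ℝ) < n := by exact_mod_cast hn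
  have h1 : ((sect a n).natDegree : ℝ) ≤ (sect a (n + 1)).natDegree := by
    exact_mod_cast natDegree_sect_mono h0 n.le_succ
  have h2 : ((sect a n).natDegree : ℝ) ≤ n := by exact_mod_cast natDegree_sect_le a n
  have h3 : ((sect a n).natDegree : ℝ) / (n + 1) ≤ (sect a (n + 1)).natDegree / (n + 1) := by
    gcongr
  have h4 : ((sect a n).natDegree : ℝ) / n - (sect a n).natDegree / (n + 1) ≤ 1 / (n + 1) := by
    rw [div_sub_div _ _ hn'.ne' (by positivity), div_le_div_iff₀ (by positivity) (by positivity)]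
    nlinarith
  simp only [degreeGap]
  push_cast
  linarith

lemma frequently_degreeGap_eq_zero {a : ℕ → ℂ} (hinf : {n | a n = 1}.Infinite) :
    ∃ᶠ n in atTop, degreeGap a n = 0 := by
  refine ((Nat.frequently_atTop_iff_infinite.mpr hinf).and_eventually
    (eventually_gt_atTop 0)).mono ?_
  rintro n ⟨h1, hn⟩
  have hd : (sect a n).natDegree = n :=
    (natDegree_sect_le a n).antisymm (le_natDegree_sect le_rfl (by simp [h1]))
  have hn' : (n : ℝ) ≠ 0 := by exact_mod_cast hn.ne'
  simp [degreeGap, hd, hn']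

lemma Acoef_eq_one {a : ℕ → ℂ} (hval : ∀ n, a n = 0 ∨ a n = 1) (h0 : a 0 = 1) {γ : ℝ} {n : ℕ}
    (hn : 0 < n) (h : degreeGap a n ≤ γ) : Acoef a γ n = 1 := by
  rw [Acoef, NNReal.coe_eq_one]
  apply le_antisymm
  · refine Finset.sup_le fun k _ => ?_
    rcases hval k with hk | hk <;> simp [hk]
  · have hmem : (sect a n).natDegree ∈
        (Finset.range (n + 1)).filter (fun k : ℕ => (1 - γ) * (n : ℝ) ≤ (k : ℝ)) := by
      simpa [Nat.lt_succ_iff, natDegree_sect_le] using (degreeGap_le_iff hn γ).mp h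
    have := Finset.le_sup (f := fun k => ‖a k‖₊) hmem
    simpa [apply_natDegree_sect hval h0] using this

lemma Acoef_eq_zero {a : ℕ → ℂ} {γ : ℝ} {n : ℕ}
    (hn : 0 < n) (h : γ < degreeGap a n) : Acoef a γ n = 0 := by
  rw [Acoef, NNReal.coe_eq_zero, ← bot_eq_zero, Finset.sup_eq_bot_iff]
  intro k hk
  simp only [Finset.mem_filter, Finset.mem_range, Nat.lt_succ_iff] at hk
  by_contra hne
  refine not_le.mpr h ((degreeGap_le_iff hn γ).mpr (hk.2.trans ?_))
  exact_mod_cast le_natDegree_sect hk.1 (by simpa [bot_eq_zero] using hne)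

lemma Lgauge_eq_one_iff {a : ℕ → ℂ} (hval : ∀ n, a n = 0 ∨ a n = 1) (h0 : a 0 = 1) {γ : ℝ} :
    Lgauge a γ = 1 ↔ ∀ᶠ n in atTop, degreeGap a n ≤ γ := by
  constructor
  · intro hL
    by_contra hne
    have hfreq : ∃ᶠ n in atTop, Acoef a γ n ^ (1 / (n : ℝ)) ≤ 0 := by
      refine ((not_eventually.mp hne).and_eventually (eventually_gt_atTop 0)).mono ?_
      rintro n ⟨h1, hn⟩
      have hn' : (1 / (n : ℝ)) ≠ 0 := by positivity
      rw [Acoef_eq_zero hn (not_le.mp h1), Real.zero_rpow hn']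
    have hle : Lgauge a γ ≤ 0 :=
      liminf_le_of_frequently_le hfreq
        (isBoundedUnder_of ⟨0, fun n => Real.rpow_nonneg (NNReal.coe_nonneg _) _⟩)
    linarith
  · intro h
    have : (fun n => Acoef a γ n ^ (1 / (n : ℝ))) =ᶠ[atTop] fun _ => (1 : ℝ) := by
      filter_upwards [h, eventually_gt_atTop 0] with n h1 hn
      rw [Acoef_eq_one hval h0 hn h1, Real.one_rpow]
    rw [Lgauge, liminf_congr this, liminf_const]

lemma indexGamma_le {a : ℕ → ℂ} (hval : ∀ n, a n = 0 ∨ a n = 1) (h0 : a 0 = 1) {γ : ℝ}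
    (hγ : γ ∈ Set.Ioo (0 : ℝ) 1) (h : ∀ᶠ n in atTop, degreeGap a n ≤ γ) : indexGamma a ≤ γ := by
  have hL := (Lgauge_eq_one_iff hval h0).mpr h
  rw [indexGamma, if_pos ⟨γ, hγ, hL⟩]
  exact csInf_le ⟨0, fun x hx => hx.1.1.le⟩ ⟨hγ, hL⟩

lemma indexGamma_le_one (a : ℕ → ℂ) : indexGamma a ≤ 1 := by
  rw [indexGamma]
  split_ifs with h
  · obtain ⟨γ, hγ, hL⟩ := h
    refine le_trans (csInf_le ⟨0, fun x hx => hx.1.1.le⟩ ?_) hγ.2.le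
    exact ⟨hγ, hL⟩
  · exact le_rfl

lemma frequently_lt_degreeGap {a : ℕ → ℂ} (hval : ∀ n, a n = 0 ∨ a n = 1) (h0 : a 0 = 1) {u : ℝ}
    (hu0 : 0 ≤ u) (hu : u < indexGamma a) : ∃ᶠ n in atTop, u < degreeGap a n := by
  intro hne
  have h1 := indexGamma_le_one a
  have := indexGamma_le hval h0 (γ := (u + indexGamma a) / 2)
    ⟨by linarith, by linarith⟩ (hne.mono fun n hn => by linarith [not_lt.mp hn])
  linarith

lemma eventually_degreeGap_le {a : ℕ → ℂ} (hval : ∀ n, a n = 0 ∨ a n = 1) (h0 : a 0 = 1) {u : ℝ}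
    (hu : indexGamma a < u) : ∀ᶠ n in atTop, degreeGap a n ≤ u := by
  by_cases h : ∃ γ ∈ Set.Ioo (0 : ℝ) 1, Lgauge a γ = 1
  · rw [indexGamma, if_pos h] at hu
    obtain ⟨γ, hγ, hlt⟩ := exists_lt_of_csInf_lt h hu
    exact ((Lgauge_eq_one_iff hval h0).mp hγ.2).mono fun n hn => hn.trans hlt.le
  · rw [indexGamma, if_neg h] at hu
    exact Eventually.of_forall fun n => (degreeGap_le_one a n).trans hu.le

lemma frequently_crossing {P : ℕ → Prop} (h1 : ∃ᶠ n in atTop, P n) (h2 : ∃ᶠ n in atTop, ¬ P n) :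
    ∃ᶠ n in atTop, ¬ P n ∧ P (n + 1) := by
  rw [frequently_atTop] at *
  intro N
  obtain ⟨m, hm, hPm⟩ := h2 N
  obtain ⟨k, hk, hPk⟩ := h1 m
  by_contra! hne
  have : ∀ j ≥ m, ¬ P j := by
    intro j hj
    induction j, hj using Nat.le_induction with
    | base => exact hPm
    | succ j hj ih => exact hne j (hm.trans hj) ih
  exact this k hk hPk

lemma frequently_degreeGap_near {a : ℕ → ℂ} (hval : ∀ n, a n = 0 ∨ a n = 1) (h0 : a 0 = 1)
    (hinf : {n | a n = 1}.Infinite) {u : ℝ} (hu0 : 0 ≤ u) (hu : u ≤ indexGamma a) {ε : ℝ}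
    (hε : 0 < ε) : ∃ᶠ n in atTop, |degreeGap a n - u| < ε := by
  by_cases hue : u < ε
  · refine (frequently_degreeGap_eq_zero hinf).mono fun n hn => ?_
    rw [hn, zero_sub, abs_neg, abs_of_nonneg hu0]
    exact hue
  push Not at hue
  have hw : 0 ≤ u - ε / 2 := by linarith
  have hcross := frequently_crossing
    (frequently_lt_degreeGap hval h0 hw (by linarith))
    ((frequently_degreeGap_eq_zero hinf).mono fun n hn => by rw [hn]; exact not_lt.mpr hw)
  have hsmall : ∀ᶠ n : ℕ in atTop, 1 / ((n : ℝ) + 1) < ε / 2 :=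
    tendsto_one_div_add_atTop_nhds_zero_nat.eventually (gt_mem_nhds (by positivity))
  have := (hcross.and_eventually (hsmall.and (eventually_gt_atTop 0)))
  refine (tendsto_add_atTop_nat 1).frequently (this.mono ?_)
  rintro n ⟨⟨h1, h2⟩, h3, hn⟩
  have := degreeGap_succ_le h0 hn
  rw [abs_lt]
  constructor <;> linarith [not_lt.mp h1]

lemma sum_abs_log_norm_roots {p : ℂ[X]} (hl : p.leadingCoeff = 1) (h0 : p.coeff 0 = 1) :
    (p.roots.map fun w => |Real.log ‖w‖|).sum = 2 * Real.log p.mahlerMeasure := by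
  have hne : (0 : ℂ) ∉ p.roots := fun h => by
    have := isRoot_of_mem_roots h
    rw [IsRoot, ← coeff_zero_eq_eval_zero, h0] at this
    exact one_ne_zero this
  have hprod : (p.roots.map fun w => ‖w‖).prod = 1 := by
    have h := (IsAlgClosed.splits p).coeff_zero_eq_leadingCoeff_mul_prod_roots
    rw [h0, hl, mul_one] at h
    have h' := congrArg (fun z : ℂ => ‖z‖) h
    simp only [norm_mul, norm_pow, norm_neg, norm_one, one_pow, one_mul] at h'
    exact (Multiset.prod_hom p.roots (normHom : ℂ →*₀ ℝ)).trans h'.symm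
  have hlog : (p.roots.map fun w => Real.log ‖w‖).sum = 0 := by
    have := Real.log_multiset_prod (s := p.roots.map fun w => ‖w‖) (by
      intro x hx
      obtain ⟨w, hw, rfl⟩ := Multiset.mem_map.mp hx
      exact norm_ne_zero_iff.mpr fun h => hne (h ▸ hw))
    rw [hprod, Real.log_one, Multiset.map_map] at this
    exact this.symm
  have hpos := logMahlerMeasure_eq_log_leadingCoeff_add_sum_log_roots p
  rw [hl, norm_one, Real.log_one, zero_add, logMahlerMeasure_eq_log_MahlerMeasure] at hpos
  rw [hpos, ← Multiset.sum_map_mul_left, ← sub_eq_zero, ← neg_eq_zero, neg_sub,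
    ← Multiset.sum_map_sub, ← hlog]
  congr 1
  refine Multiset.map_congr rfl fun w _ => ?_
  rw [← Real.half_mul_log_add_log_abs]
  ring

lemma mahlerMeasure_sect_le {a : ℕ → ℂ} (hval : ∀ n, a n = 0 ∨ a n = 1) (n : ℕ) :
    (sect a n).mahlerMeasure ≤ n + 1 := by
  refine (mahlerMeasure_le_sum_norm_coeff _).trans ?_
  rw [sum_over_range' _ (by simp) (n + 1) (Nat.lt_succ_of_le (natDegree_sect_le a n))]
  have : ∀ k ∈ Finset.range (n + 1), ‖(sect a n).coeff k‖ ≤ 1 := by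
    intro k _
    rw [coeff_sect]
    split_ifs
    · rcases hval k with h | h <;> simp [h]
    · simp
  simpa using Finset.sum_le_sum this

lemma sum_abs_log_norm_roots_sect_le {a : ℕ → ℂ} (hval : ∀ n, a n = 0 ∨ a n = 1) (h0 : a 0 = 1)
    (n : ℕ) : ((sect a n).roots.map fun w => |Real.log ‖w‖|).sum ≤ 2 * Real.log (n + 1) := by
  rw [sum_abs_log_norm_roots (by rw [leadingCoeff_sect a, apply_natDegree_sect hval h0])
    (by simp [coeff_sect, h0])]
  gcongr
  · exact mahlerMeasure_pos_of_ne_zero (sect_ne_zero h0 n)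
  · exact mahlerMeasure_sect_le hval n

lemma isFiniteMeasure_and_integral_sum_dirac {ι : Type*} (s : Multiset ι) (f : ι → ℝ≥0∞)
    (h : C(ℝ≥0∞, ℝ)) :
    IsFiniteMeasure (s.map fun i => Measure.dirac (f i)).sum ∧
      ∫ x, h x ∂(s.map fun i => Measure.dirac (f i)).sum = (s.map fun i => h (f i)).sum := by
  induction s using Multiset.induction with
  | empty =>
    simp only [Multiset.map_zero, Multiset.sum_zero, integral_zero_measure, and_true]
    infer_instance
  | cons i s ih =>
    obtain ⟨ih1, ih2⟩ := ih
    simp only [Multiset.map_cons, Multiset.sum_cons]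
    refine ⟨inferInstance, ?_⟩
    rw [integral_add_measure, ih2, integral_dirac]
    · exact (BoundedContinuousFunction.mkOfCompact h).integrable _
    · exact (BoundedContinuousFunction.mkOfCompact h).integrable _

lemma integral_rho (a : ℕ → ℂ) (n : ℕ) (h : C(ℝ≥0∞, ℝ)) :
    ∫ x, h x ∂(rho a n) = (n : ℝ)⁻¹ *
      (((sect a n).roots.map fun w => h (‖w‖₊ : ℝ≥0∞)).sum
        + ((n : ℝ) - (sect a n).natDegree) * h ⊤) := by
  obtain ⟨h1, h2⟩ := isFiniteMeasure_and_integral_sum_dirac (sect a n).roots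
    (fun w => (‖w‖₊ : ℝ≥0∞)) h
  have hfin : IsFiniteMeasure ((n - (sect a n).natDegree) • Measure.dirac (⊤ : ℝ≥0∞)) := by
    rw [← Nat.cast_smul_eq_nsmul ℝ≥0∞]
    exact Measure.smul_finite _ (ENNReal.natCast_ne_top _)
  rw [rho, integral_smul_measure, integral_add_measure, h2, ← Nat.cast_smul_eq_nsmul ℝ≥0∞,
    integral_smul_measure, integral_dirac, ENNReal.toReal_inv, ENNReal.toReal_natCast,
    ENNReal.toReal_natCast, Nat.cast_sub (natDegree_sect_le a n), smul_eq_mul, smul_eq_mul]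
  · exact (BoundedContinuousFunction.mkOfCompact h).integrable _
  · exact (BoundedContinuousFunction.mkOfCompact h).integrable _

lemma exists_abs_sub_le_add_mul_abs_log (h : C(ℝ≥0∞, ℝ)) {ε : ℝ} (hε : 0 < ε) :
    ∃ K : ℝ, 0 ≤ K ∧ ∀ x : NNReal, x ≠ 0 →
      |h (x : ℝ≥0∞) - h 1| ≤ ε + K * |Real.log x| := by
  have hcont : Continuous fun t : ℝ => h (ENNReal.ofReal (Real.exp t)) :=
    h.continuous.comp (ENNReal.continuous_ofReal.comp Real.continuous_exp)
  obtain ⟨δ, hδ, hd⟩ := Metric.continuous_iff.mp hcont 0 ε hε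
  refine ⟨2 * ‖h‖ / δ, by positivity, fun x hx => ?_⟩
  have hx' : (0 : ℝ) < x := by positivity
  by_cases hlog : |Real.log x| < δ
  · have := hd (Real.log x) (by simpa [Real.dist_eq] using hlog)
    rw [Real.exp_log hx', ENNReal.ofReal_coe_nnreal, Real.exp_zero, ENNReal.ofReal_one,
      Real.dist_eq] at this
    have : 0 ≤ 2 * ‖h‖ / δ * |Real.log x| := by positivity
    linarith
  · have h1 : |h (x : ℝ≥0∞) - h 1| ≤ 2 * ‖h‖ := by
      have := norm_sub_le (h (x : ℝ≥0∞)) (h 1)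
      have h2 := h.norm_coe_le_norm (x : ℝ≥0∞)
      have h3 := h.norm_coe_le_norm 1
      rw [Real.norm_eq_abs] at this
      linarith
    have h4 : 2 * ‖h‖ / δ * δ ≤ 2 * ‖h‖ / δ * |Real.log x| := by
      gcongr
      exact not_lt.mp hlog
    rw [div_mul_cancel₀ _ hδ.ne'] at h4
    linarith

lemma tendsto_integral_rho_sub {a : ℕ → ℂ} (hval : ∀ n, a n = 0 ∨ a n = 1) (h0 : a 0 = 1)
    (h : C(ℝ≥0∞, ℝ)) :
    Tendsto (fun n => ∫ x, h x ∂(rho a n)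
      - ((1 - degreeGap a n) * h 1 + degreeGap a n * h ⊤)) atTop (nhds 0) := by
  have hlim : Tendsto (fun n : ℕ => Real.log ((n : ℝ) + 1) / n) atTop (nhds 0) := by
    have h1 : Tendsto (fun n : ℕ => Real.log ((n : ℝ) + 1) / ((n : ℝ) + 1)) atTop (nhds 0) :=
      (Real.isLittleO_log_id_atTop.tendsto_div_nhds_zero).comp
        (tendsto_atTop_add_const_right _ 1 tendsto_natCast_atTop_atTop)
    have h2 : Tendsto (fun n : ℕ => ((n : ℝ) + 1) / n) atTop (nhds 1) := by
      have : Tendsto (fun n : ℕ => 1 + 1 / (n : ℝ)) atTop (nhds (1 + 0)) :=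
        tendsto_const_nhds.add tendsto_one_div_atTop_nhds_zero_nat
      rw [add_zero] at this
      refine this.congr' ?_
      filter_upwards [eventually_gt_atTop 0] with n hn
      have : (n : ℝ) ≠ 0 := by exact_mod_cast hn.ne'
      field_simp
    have := h1.mul h2
    rw [zero_mul] at this
    refine this.congr fun n => ?_
    have : (n : ℝ) + 1 ≠ 0 := by positivity
    rw [div_mul_div_cancel₀ this]
  rw [Metric.tendsto_atTop']
  intro ε hε
  obtain ⟨K, hK, hbound⟩ := exists_abs_sub_le_add_mul_abs_log h (half_pos hε)
  have hev : ∀ᶠ n : ℕ in atTop, K * 2 * (Real.log ((n : ℝ) + 1) / n) < ε / 2 := by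
    have := hlim.const_mul (K * 2)
    rw [mul_zero] at this
    exact this.eventually (gt_mem_nhds (half_pos hε))
  obtain ⟨N, hN⟩ := eventually_atTop.mp hev
  refine ⟨N, fun n hn => ?_⟩
  have hn0 : (0 : ℝ) < n := by exact_mod_cast (Nat.zero_le N).trans_lt hn
  specialize hN n hn.le
  have hcard : ((sect a n).roots.card : ℝ) = (sect a n).natDegree := by
    rw [(IsAlgClosed.splits (sect a n)).natDegree_eq_card_roots]
  have hdeg : ((sect a n).natDegree : ℝ) ≤ n := by exact_mod_cast natDegree_sect_le a n
  have heq : ∫ x, h x ∂(rho a n) - ((1 - degreeGap a n) * h 1 + degreeGap a n * h ⊤)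
      = (n : ℝ)⁻¹ * ((sect a n).roots.map fun w => h (‖w‖₊ : ℝ≥0∞) - h 1).sum := by
    rw [integral_rho, Multiset.sum_map_sub, Multiset.map_const', Multiset.sum_replicate,
      nsmul_eq_mul, hcard, degreeGap]
    field_simp
    ring
  have hsum : |((sect a n).roots.map fun w => h (‖w‖₊ : ℝ≥0∞) - h 1).sum|
      ≤ n * (ε / 2) + K * (2 * Real.log (n + 1)) := by
    calc _ ≤ ((sect a n).roots.map fun w => |h (‖w‖₊ : ℝ≥0∞) - h 1|).sum := by
          simpa [Multiset.map_map, Function.comp_def] using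
            Multiset.abs_sum_le_sum_abs (s := (sect a n).roots.map fun w => h (‖w‖₊ : ℝ≥0∞) - h 1)
      _ ≤ ((sect a n).roots.map fun w => ε / 2 + K * |Real.log ‖w‖|).sum := by
          refine Multiset.sum_map_le_sum_map _ _ fun w hw => ?_
          have hw0 : w ≠ 0 := by
            rintro rfl
            have := isRoot_of_mem_roots hw
            rw [IsRoot, ← coeff_zero_eq_eval_zero, coeff_sect] at this
            simp [h0] at this
          exact hbound ‖w‖₊ (by simpa using hw0)
      _ = (sect a n).natDegree * (ε / 2)
            + K * ((sect a n).roots.map fun w => |Real.log ‖w‖|).sum := by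
          rw [Multiset.sum_map_add, Multiset.map_const', Multiset.sum_replicate, nsmul_eq_mul,
            hcard, Multiset.sum_map_mul_left]
      _ ≤ _ := by
          gcongr
          exact sum_abs_log_norm_roots_sect_le hval h0 n
  rw [Real.dist_eq, sub_zero, heq, abs_mul, abs_of_pos (inv_pos.mpr hn0)]
  calc _ ≤ (n : ℝ)⁻¹ * (n * (ε / 2) + K * (2 * Real.log (n + 1))) := by gcongr
    _ = ε / 2 + K * 2 * (Real.log ((n : ℝ) + 1) / n) := by field_simp
    _ < ε := by linarith

lemma integral_two_atoms (h : C(ℝ≥0∞, ℝ)) {u : ℝ} (hu0 : 0 ≤ u) (hu1 : u ≤ 1) :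
    ∫ x, h x ∂(ENNReal.ofReal (1 - u) • Measure.dirac (1 : ℝ≥0∞)
      + ENNReal.ofReal u • Measure.dirac (⊤ : ℝ≥0∞)) = (1 - u) * h 1 + u * h ⊤ := by
  rw [integral_add_measure, integral_smul_measure, integral_smul_measure, integral_dirac,
    integral_dirac, ENNReal.toReal_ofReal (by linarith), ENNReal.toReal_ofReal hu0, smul_eq_mul,
    smul_eq_mul]
  · exact ((BoundedContinuousFunction.mkOfCompact h).integrable _).smul_measure
      ENNReal.ofReal_ne_top
  · exact ((BoundedContinuousFunction.mkOfCompact h).integrable _).smul_measure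
      ENNReal.ofReal_ne_top

lemma tendsto_integral_rho {a : ℕ → ℂ} (hval : ∀ n, a n = 0 ∨ a n = 1) (h0 : a 0 = 1)
    {nk : ℕ → ℕ} (hnk : Tendsto nk atTop atTop) {u : ℝ}
    (hu : Tendsto (fun k => degreeGap a (nk k)) atTop (nhds u)) (h : C(ℝ≥0∞, ℝ)) :
    Tendsto (fun k => ∫ x, h x ∂(rho a (nk k))) atTop (nhds ((1 - u) * h 1 + u * h ⊤)) := by
  have h1 := (tendsto_integral_rho_sub hval h0 h).comp hnk
  have h2 := ((hu.const_sub 1).mul_const (h 1)).add (hu.mul_const (h ⊤))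
  simpa [Function.comp_def] using h1.add h2

theorem limit_points_of_zero_one_series (a : ℕ → ℂ)
    (hval : ∀ n, a n = 0 ∨ a n = 1) (h0 : a 0 = 1)
    (hinf : {n | a n = 1}.Infinite) :
    ∀ ρ : Measure ℝ≥0∞, IsProbabilityMeasure ρ →
      ((∃ nk : ℕ → ℕ, StrictMono nk ∧ (∀ k, 1 ≤ nk k) ∧
          ∀ h : C(ℝ≥0∞, ℝ),
            Filter.Tendsto (fun k => ∫ x, h x ∂(rho a (nk k))) Filter.atTop
              (nhds (∫ x, h x ∂ρ))) ↔
        (∃ u : ℝ, 0 ≤ u ∧ u ≤ indexGamma a ∧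
          ρ = ENNReal.ofReal (1 - u) • Measure.dirac (1 : ℝ≥0∞)
            + ENNReal.ofReal u • Measure.dirac (⊤ : ℝ≥0∞))) := by
  intro ρ hρ
  constructor
  · rintro ⟨nk, hmono, -, hlim⟩
    obtain ⟨u, hu, φ, hφ, hconv⟩ := (isCompact_Icc (a := (0 : ℝ)) (b := 1)).tendsto_subseq
      (x := fun k => degreeGap a (nk k))
      fun k => ⟨degreeGap_nonneg a _, degreeGap_le_one a _⟩
    have htop : Tendsto (nk ∘ φ) atTop atTop := (hmono.comp hφ).tendsto_atTop
    refine ⟨u, hu.1, ?_, ?_⟩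
    · by_contra! hlt
      obtain ⟨c, hc1, hc2⟩ := exists_between hlt
      have := le_of_tendsto hconv (htop.eventually (eventually_degreeGap_le hval h0 hc1))
      linarith
    · have hfin1 : IsFiniteMeasure (ENNReal.ofReal (1 - u) • Measure.dirac (1 : ℝ≥0∞)) :=
        Measure.smul_finite _ ENNReal.ofReal_ne_top
      have hfin2 : IsFiniteMeasure (ENNReal.ofReal u • Measure.dirac (⊤ : ℝ≥0∞)) :=
        Measure.smul_finite _ ENNReal.ofReal_ne_top
      refine ext_of_forall_integral_eq_of_IsFiniteMeasure fun f => ?_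
      exact (tendsto_nhds_unique ((hlim f.toContinuousMap).comp hφ.tendsto_atTop)
        (tendsto_integral_rho hval h0 htop hconv f.toContinuousMap)).trans
        (integral_two_atoms f.toContinuousMap hu.1 hu.2).symm
  · rintro ⟨u, hu0, hu, rfl⟩
    obtain ⟨nk, hmono, hnk⟩ := extraction_forall_of_frequently
      (P := fun k n => |degreeGap a n - u| < 1 / ((k : ℝ) + 1) ∧ 1 ≤ n) fun k =>
        (frequently_degreeGap_near hval h0 hinf hu0 hu
          (Nat.one_div_pos_of_nat (n := k))).and_eventually (eventually_ge_atTop 1)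
    refine ⟨nk, hmono, fun k => (hnk k).2, fun h => ?_⟩
    rw [integral_two_atoms h hu0 (hu.trans (indexGamma_le_one a))]
    refine tendsto_integral_rho hval h0 hmono.tendsto_atTop ?_ h
    rw [tendsto_iff_dist_tendsto_zero]
    exact squeeze_zero (fun _ => dist_nonneg) (fun k => (hnk k).1.le)
      tendsto_one_div_add_atTop_nhds_zero_nat
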